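/- Let k be an algebraically closed field, Q a strongly locally finite quiver and A = kQ its path category. Then every submodule of a finite direct sum ⊕_{i=1}^r P_{x_i} of projective modules P_{x_i} = Hom_A(x_i,−) is isomorphic to a (possibly infinite) direct sum of modules of the form P_y = Hom_A(y,−) for vertices y of Q; in particular, it is a direct sum of finitely generated projective modules. -/

import Mathlib

open CategoryTheory CategoryTheory.Limits

namespace Paper

variable (k : Type) [Field k]

section General

variable (A : Type) [Category.{0} A] [Preadditive A] [CategoryTheory.Linear k A]

/-- A spectroid over `k`: a (small) Hom-finite `k`-linear category in which every object
has a local endomorphism ring and distinct objects are not isomorphic. -/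
class Spectroid : Prop where
  homFinite : ∀ a b : A, FiniteDimensional k (a ⟶ b)
  localEnd : ∀ a : A, IsLocalRing (End a)
  skeletal : ∀ a b : A, (a ≅ b) → a = b

variable {A}

/-- `M` is a module over `A`, i.e. the functor `M : A ⥤ ModuleCat k` is additive and
`k`-linear on morphisms. -/
def IsMod (M : A ⥤ ModuleCat.{0} k) : Prop :=
  (∀ {a b : A} (f g : a ⟶ b), M.map (f + g) = M.map f + M.map g) ∧
  (∀ {a b : A} (r : k) (f : a ⟶ b), M.map (r • f) = r • M.map f)

/-- `M` is a locally finite dimensional module over `A`, i.e. an object of `mod A`. -/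
def IsLfdMod (M : A ⥤ ModuleCat.{0} k) : Prop :=
  IsMod k M ∧ ∀ a : A, FiniteDimensional k (M.obj a)

/-- The projective module `P_a = Hom_A(a, -)` at an object `a`. -/
noncomputable def ProjAt (a : A) : A ⥤ ModuleCat.{0} k :=
  (linearCoyoneda k A).obj (Opposite.op a)

/-- The injective module `I_a = D Hom_A(-, a)` at an object `a`. -/
noncomputable def InjAt (a : A) : A ⥤ ModuleCat.{0} k where
  obj b := ModuleCat.of k (Module.Dual k (b ⟶ a))
  map {b c} f := ModuleCat.ofHom (LinearMap.dualMap (Linear.leftComp k a f))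
  map_id b := by
    have h : Linear.leftComp k a (𝟙 b) = LinearMap.id := by
      apply LinearMap.ext; intro g; simp
    rw [h, LinearMap.dualMap_id]; rfl
  map_comp {b c d} f g := by
    have h : Linear.leftComp k a (f ≫ g) =
        (Linear.leftComp k a f).comp (Linear.leftComp k a g) := by
      apply LinearMap.ext; intro h; simp
    rw [h]; rfl

instance : HasFiniteBiproducts (A ⥤ ModuleCat.{0} k) :=
  CategoryTheory.Abelian.hasFiniteBiproducts

/-- `M` is finitely generated: there is an epimorphism `⊕_{i=1}^r P_{a_i} → M`. -/
def IsFG (M : A ⥤ ModuleCat.{0} k) : Prop :=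
  ∃ (r : ℕ) (a : Fin r → A) (f : (⨁ fun i => ProjAt k (a i)) ⟶ M), Epi f

/-- `M` is finitely presented: there is an epimorphism `⊕_{i=1}^r P_{a_i} → M` with
finitely generated kernel. -/
def IsFP (M : A ⥤ ModuleCat.{0} k) : Prop :=
  ∃ (r : ℕ) (a : Fin r → A) (f : (⨁ fun i => ProjAt k (a i)) ⟶ M),
    Epi f ∧ IsFG k (kernel f)

/-- `M` is finitely co-generated: there is a monomorphism `M → ⊕_{j=1}^s I_{b_j}`. -/
def IsFCG (M : A ⥤ ModuleCat.{0} k) : Prop :=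
  ∃ (s : ℕ) (b : Fin s → A) (f : M ⟶ ⨁ fun j => InjAt k (b j)), Mono f

/-- `M` is finitely co-presented: there is a monomorphism `M → ⊕_{j=1}^s I_{b_j}` with
finitely co-generated cokernel. -/
def IsFCP (M : A ⥤ ModuleCat.{0} k) : Prop :=
  ∃ (s : ℕ) (b : Fin s → A) (f : M ⟶ ⨁ fun j => InjAt k (b j)),
    Mono f ∧ IsFCG k (cokernel f)

/-- `f` is an irreducible morphism in `mod A`: it is neither a split mono nor a split epi,
and in any factorization `f = g ≫ h` through an object of `mod A`, `g` is a split mono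
or `h` is a split epi. -/
def Irred {L M : A ⥤ ModuleCat.{0} k} (f : L ⟶ M) : Prop :=
  ¬ IsSplitMono f ∧ ¬ IsSplitEpi f ∧
    ∀ ⦃X : A ⥤ ModuleCat.{0} k⦄, IsLfdMod k X →
      ∀ (g : L ⟶ X) (h : X ⟶ M), g ≫ h = f → IsSplitMono g ∨ IsSplitEpi h

/-- `M` is an indecomposable object of `mod A`: it is nonzero, and whenever `M ≅ X ⊞ Y`
with `X`, `Y` in `mod A`, one of `X`, `Y` is zero. -/
def Indec (M : A ⥤ ModuleCat.{0} k) : Prop :=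
  ¬ IsZero M ∧ ∀ ⦃X Y : A ⥤ ModuleCat.{0} k⦄, IsLfdMod k X → IsLfdMod k Y →
    (M ≅ X ⊞ Y) → IsZero X ∨ IsZero Y

/-- `0 → L →f M →g N → 0` is an almost split sequence in `mod A`. -/
structure AlmostSplitSeq {L M N : A ⥤ ModuleCat.{0} k} (f : L ⟶ M) (g : M ⟶ N) : Prop where
  mono : Mono f
  epi : Epi g
  zero : f ≫ g = 0
  exact : (ShortComplex.mk f g zero).Exact
  not_splitMono : ¬ IsSplitMono f
  not_splitEpi : ¬ IsSplitEpi g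
  left_almost_split : ∀ ⦃X : A ⥤ ModuleCat.{0} k⦄, IsLfdMod k X →
    ∀ u : L ⟶ X, ¬ IsSplitMono u → ∃ v : M ⟶ X, f ≫ v = u
  right_almost_split : ∀ ⦃X : A ⥤ ModuleCat.{0} k⦄, IsLfdMod k X →
    ∀ u : X ⟶ N, ¬ IsSplitEpi u → ∃ v : X ⟶ M, v ≫ g = u

/-- `M` is projective as an object of `mod A`. -/
def ProjInMod (M : A ⥤ ModuleCat.{0} k) : Prop :=
  ∀ ⦃X Y : A ⥤ ModuleCat.{0} k⦄, IsLfdMod k X → IsLfdMod k Y →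
    ∀ (e : X ⟶ Y), Epi e → ∀ u : M ⟶ Y, ∃ t : M ⟶ X, t ≫ e = u

/-- `M` is injective as an object of `mod A`. -/
def InjInMod (M : A ⥤ ModuleCat.{0} k) : Prop :=
  ∀ ⦃X Y : A ⥤ ModuleCat.{0} k⦄, IsLfdMod k X → IsLfdMod k Y →
    ∀ (m : X ⟶ Y), Mono m → ∀ u : X ⟶ M, ∃ t : Y ⟶ M, m ≫ t = u

/-- `h` is a (nonempty) composition of irreducible morphisms between indecomposable
objects of `mod A`. -/
inductive IrredChain : ∀ {X Y : A ⥤ ModuleCat.{0} k}, (X ⟶ Y) → Prop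
  | single {X Y : A ⥤ ModuleCat.{0} k} (f : X ⟶ Y) :
      IsLfdMod k X → Indec k X → IsLfdMod k Y → Indec k Y → Irred k f → IrredChain f
  | comp {X Y Z : A ⥤ ModuleCat.{0} k} (f : X ⟶ Y) (g : Y ⟶ Z) :
      IsLfdMod k X → Indec k X → Irred k f → IrredChain g → IrredChain (f ≫ g)

end General

section QuiverSection

variable (Q : Type) [Quiver.{0} Q]

/-- `Q` is locally finite: every vertex is the source of finitely many arrows and the
target of finitely many arrows. -/
def LocallyFinite : Prop :=
  ∀ x : Q, Finite (Σ y : Q, x ⟶ y) ∧ Finite (Σ y : Q, y ⟶ x)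

/-- `Q` is interval finite: there are finitely many paths between any two vertices. -/
def IntervalFinite : Prop :=
  ∀ x y : Q, Finite (Quiver.Path x y)

/-- `Q` is strongly locally finite: locally finite and interval finite. -/
def StronglyLocallyFinite : Prop :=
  LocallyFinite Q ∧ IntervalFinite Q

/-- `Q` is connected: nonempty, and any two vertices are joined by a walk. -/
def QuiverConnected : Prop :=
  Nonempty Q ∧ ∀ x y : Q,
    Nonempty (Quiver.Path (Quiver.Symmetrify.of.obj x) (Quiver.Symmetrify.of.obj y))

/-- The path category `kQ` of the quiver `Q`: the free `k`-linear category on the free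
category on `Q`. -/
abbrev PathCat := CategoryTheory.Free k (Paths Q)

/-- A vertex of `Q`, seen as an object of the path category `kQ`. -/
noncomputable def vtx (x : Q) : PathCat k Q :=
  (Free.embedding k (Paths Q)).obj ((Paths.of Q).obj x)

/-- An arrow of `Q`, seen as a morphism of the path category `kQ`. -/
noncomputable def arrHom {x y : Q} (α : x ⟶ y) : vtx k Q x ⟶ vtx k Q y :=
  (Free.embedding k (Paths Q)).map ((Paths.of Q).map α)

/-- The degree of a vertex of `Q`: the total number of arrows incident to it. -/
noncomputable def degree (x : Q) : ℕ :=
  Nat.card ((Σ y : Q, x ⟶ y) ⊕ (Σ y : Q, y ⟶ x))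

/-- `M` belongs to `rrep(Q)`: it is the middle term of a short exact sequence
`0 → L → M → N → 0` with `L` finitely presented, `N` finitely co-presented, and only
finitely many arrows `α` of `Q` satisfy `M(α) ≠ 0`, `L(α) = 0` and `N(α) = 0`. -/
def InRrep (M : PathCat k Q ⥤ ModuleCat.{0} k) : Prop :=
  ∃ (L N : PathCat k Q ⥤ ModuleCat.{0} k) (f : L ⟶ M) (g : M ⟶ N) (zero : f ≫ g = 0),
    Mono f ∧ Epi g ∧ (ShortComplex.mk f g zero).Exact ∧ IsFP k L ∧ IsFCP k N ∧
    Set.Finite {p : Σ (x : Q) (y : Q), x ⟶ y |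
      M.map (arrHom k Q p.2.2) ≠ 0 ∧ L.map (arrHom k Q p.2.2) = 0 ∧
      N.map (arrHom k Q p.2.2) = 0}

variable {Q}

/-- The vertices occurring in a path. -/
def InPath {x : Q} : ∀ {y : Q}, Quiver.Path x y → Q → Prop
  | _, Quiver.Path.nil, v => v = x
  | _, @Quiver.Path.cons _ _ _ _ c p _, v => v = c ∨ InPath p v

variable (Q)

/-- `Q` is a star quiver: it is obtained from a finite full convex subquiver `Γ` by
attaching finitely many rays and co-rays with no common vertices. -/
def IsStarQuiver : Prop :=
  ∃ (Γ S₁ S₂ : Set Q) (v : Q → ℕ → Q),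
    Γ.Finite ∧ S₁ ⊆ Γ ∧ S₂ ⊆ Γ ∧ Disjoint S₁ S₂ ∧
    (∀ x y : Q, x ∈ Γ → y ∈ Γ → ∀ p : Quiver.Path x y, ∀ z : Q, InPath p z → z ∈ Γ) ∧
    (∀ s ∈ S₁ ∪ S₂, ∀ i : ℕ, v s i ∉ Γ) ∧
    (∀ s ∈ S₁ ∪ S₂, ∀ t ∈ S₁ ∪ S₂, ∀ i j : ℕ, v s i = v t j → s = t ∧ i = j) ∧
    (∀ x : Q, x ∉ Γ → ∃ s ∈ S₁ ∪ S₂, ∃ i : ℕ, x = v s i) ∧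
    (∀ s ∈ S₁, Nat.card (s ⟶ v s 0) = 1 ∧ ∀ i : ℕ, Nat.card (v s i ⟶ v s (i + 1)) = 1) ∧
    (∀ s ∈ S₂, Nat.card (v s 0 ⟶ s) = 1 ∧ ∀ i : ℕ, Nat.card (v s (i + 1) ⟶ v s i) = 1) ∧
    (∀ x y : Q, (x ⟶ y) → ¬(x ∈ Γ ∧ y ∈ Γ) →
      (∃ s ∈ S₁, (x = s ∧ y = v s 0) ∨ ∃ i : ℕ, x = v s i ∧ y = v s (i + 1)) ∨
      (∃ s ∈ S₂, (x = v s 0 ∧ y = s) ∨ ∃ i : ℕ, x = v s (i + 1) ∧ y = v s i))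

end QuiverSection

section FreeRepresentation

variable {k} {Q : Type} [Quiver.{0} Q]
variable {V : Q → Type} [∀ v, AddCommGroup (V v)] [∀ v, Module k (V v)]

/-- The action of a path on a representation of a quiver. -/
def pathAct (act : ∀ ⦃v w : Q⦄, (v ⟶ w) → V v →ₗ[k] V w) {v : Q} :
    ∀ {w : Q}, Quiver.Path v w → V v →ₗ[k] V w
  | _, Quiver.Path.nil => LinearMap.id
  | _, Quiver.Path.cons p a => act a ∘ₗ pathAct act p

variable (act : ∀ ⦃v w : Q⦄, (v ⟶ w) → V v →ₗ[k] V w) [∀ y : Q, Fintype (Σ z : Q, z ⟶ y)]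

/-- The sum of the actions of all arrows ending at `y`; its range is the radical at `y`. -/
def incoming (y : Q) : (∀ a : Σ z : Q, z ⟶ y, V a.1) →ₗ[k] V y :=
  ∑ a, act a.2 ∘ₗ LinearMap.proj a

lemma incoming_apply (y : Q) (u : ∀ a : Σ z : Q, z ⟶ y, V a.1) :
    incoming act y u = ∑ a, act a.2 (u a) := by
  simp [incoming]

open Classical in
lemma incoming_single (y : Q) (a : Σ z : Q, z ⟶ y) (u : V a.1) :
    incoming act y (Pi.single a u) = act a.2 u := by
  rw [incoming_apply, Finset.sum_eq_single a]
  · simp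
  · intro b _ hb
    simp [Pi.single_eq_of_ne hb]
  · simp

variable {act}

lemma act_injective (h : ∀ y, Function.Injective (incoming act y)) {z y : Q} (a : z ⟶ y) :
    Function.Injective (act a) := by
  classical
  intro u u' huu
  have := h y (a₁ := Pi.single ⟨z, a⟩ u) (a₂ := Pi.single ⟨z, a⟩ u')
    (by simpa [incoming_single] using huu)
  exact Pi.single_injective (M := fun a : Σ z : Q, z ⟶ y => V a.1) ⟨z, a⟩ this

lemma pathAct_injective (h : ∀ y, Function.Injective (incoming act y)) {z y : Q}
    (p : Quiver.Path z y) : Function.Injective (pathAct act p) := by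
  induction p with
  | nil => exact fun _ _ h => h
  | cons p a ih => exact (act_injective h a).comp ih

/-- Each vector at `v` is a combination of path translates of vectors complementing the radical. -/
lemma span_pathAct_eq_top {ι : Type} {y : ι → Q} {b : ∀ j, V (y j)} {d : Q → ℕ}
    (hd : ∀ ⦃z v : Q⦄, (z ⟶ v) → Nontrivial (V z) → d z < d v)
    (hb : ∀ v, Submodule.span k {m | ∃ j, ∃ h : y j = v, h ▸ b j = m} ⊔
      LinearMap.range (incoming act v) = ⊤) (v : Q) :
    Submodule.span k (Set.range fun p : Σ j, Quiver.Path (y j) v => pathAct act p.2 (b p.1)) =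
      ⊤ := by
  induction hn : d v using Nat.strong_induction_on generalizing v with
  | _ n ih =>
    rw [eq_top_iff, ← hb v, sup_le_iff, Submodule.span_le]
    refine ⟨?_, ?_⟩
    · rintro _ ⟨j, rfl, rfl⟩
      exact Submodule.subset_span ⟨⟨j, Quiver.Path.nil⟩, rfl⟩
    · rintro _ ⟨u, rfl⟩
      rw [incoming_apply]
      refine Submodule.sum_mem _ fun a _ => ?_
      obtain ⟨z, a⟩ := a
      have key : Submodule.span k (Set.range fun p : Σ j, Quiver.Path (y j) z =>
          pathAct act p.2 (b p.1)) = ⊤ := by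
        rcases subsingleton_or_nontrivial (V z) with hz | hz
        · exact Subsingleton.elim _ _
        · exact ih (d z) (hn ▸ hd a hz) z rfl
      have hmem : act a (u ⟨z, a⟩) ∈ (⊤ : Submodule k (V z)).map (act a) :=
        Submodule.mem_map_of_mem trivial
      rw [← key, Submodule.map_span, ← Set.range_comp] at hmem
      refine Submodule.span_mono ?_ hmem
      rintro _ ⟨p, rfl⟩
      exact ⟨⟨p.1, p.2.cons a⟩, rfl⟩

/-- Path translates of vectors which are independent modulo the radical are independent, as soon
as the incoming arrows at each vertex act jointly injectively. -/
lemma linearIndependent_pathAct {I : Q → Type} {b : ∀ v, I v → V v} {d : Q → ℕ}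
    (hd : ∀ ⦃z v : Q⦄, (z ⟶ v) → Nontrivial (V z) → d z < d v)
    (h : ∀ y, Function.Injective (incoming act y))
    (hb : ∀ v, LinearIndependent k (b v))
    (hdisj : ∀ v, Disjoint (Submodule.span k (Set.range (b v)))
      (LinearMap.range (incoming act v))) (v : Q) :
    LinearIndependent k fun p : Σ j : (Σ w, I w), Quiver.Path j.1 v =>
      pathAct act p.2 (b p.1.1 p.1.2) := by
  classical
  induction hn : d v using Nat.strong_induction_on generalizing v with
  | _ n ih =>
    have key : ∀ a : Σ z : Q, z ⟶ v, LinearIndependent k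
        fun p : Σ j : (Σ w, I w), Quiver.Path j.1 a.1 => pathAct act p.2 (b p.1.1 p.1.2) := by
      intro a
      rcases subsingleton_or_nontrivial (V a.1) with hz | hz
      · have : IsEmpty (Σ j : (Σ w, I w), Quiver.Path j.1 a.1) := by
          refine ⟨fun p => (hb p.1.1).ne_zero p.1.2 (pathAct_injective h p.2 ?_)⟩
          exact Subsingleton.elim _ _
        exact linearIndependent_empty_type
      · exact ih (d a.1) (hn ▸ hd a.2 hz) a.1 rfl
    have hinc := (Pi.linearIndependent_single _ key).map' (incoming act v)
      (LinearMap.ker_eq_bot.2 (h v))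
    have hsum := (hb v).sum_type hinc ((hdisj v).mono_right (Submodule.span_le.2 (by
      rintro _ ⟨q, rfl⟩
      exact ⟨_, rfl⟩)))
    let e : (Σ j : (Σ w, I w), Quiver.Path j.1 v) →
        I v ⊕ (Σ a : (Σ z : Q, z ⟶ v), Σ j : (Σ w, I w), Quiver.Path j.1 a.1) := fun p =>
      match p with
      | ⟨⟨_, i⟩, Quiver.Path.nil⟩ => Sum.inl i
      | ⟨j, Quiver.Path.cons q a⟩ => Sum.inr ⟨⟨_, a⟩, j, q⟩
    have he : Function.Injective e := by
      rintro ⟨⟨w, i⟩, p⟩ ⟨⟨w', i'⟩, p'⟩ hpp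
      cases p <;> cases p' <;> simp only [e] at hpp
      · cases hpp; rfl
      · cases hpp
      · cases hpp
      · cases hpp; rfl
    have hcomp : (fun p : Σ j : (Σ w, I w), Quiver.Path j.1 v => pathAct act p.2 (b p.1.1 p.1.2)) =
        Sum.elim (b v) (incoming act v ∘ fun q : Σ a : (Σ z : Q, z ⟶ v),
          Σ j : (Σ w, I w), Quiver.Path j.1 a.1 =>
            Pi.single q.1 (pathAct act q.2.2 (b q.2.1.1 q.2.1.2))) ∘ e := by
      funext ⟨⟨w, i⟩, p⟩
      cases p
      · rfl
      · simp only [e, Function.comp_apply, Sum.elim_inr, incoming_single]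
        rfl
    rw [hcomp]
    exact hsum.comp e he

/-- A bounded representation in which the incoming arrows at each vertex act jointly injectively
has a basis made of path translates of a family of vectors. -/
theorem exists_basis_pathAct {d : Q → ℕ}
    (hd : ∀ ⦃z v : Q⦄, (z ⟶ v) → Nontrivial (V z) → d z < d v)
    (h : ∀ y, Function.Injective (incoming act y)) :
    ∃ (ι : Type) (y : ι → Q) (b : ∀ j, V (y j)),
      ∀ v, ∃ B : Module.Basis (Σ j, Quiver.Path (y j) v) k (V v),
        ∀ p, B p = pathAct act p.2 (b p.1) := by
  have hcompl : ∀ v, ∃ (I : Type) (b : I → V v), LinearIndependent k b ∧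
      IsCompl (Submodule.span k (Set.range b)) (LinearMap.range (incoming act v)) := fun v => by
    obtain ⟨C, hC⟩ := Submodule.exists_isCompl (LinearMap.range (incoming act v))
    let B := Module.Basis.ofVectorSpace k C
    refine ⟨_, C.subtype ∘ B, B.linearIndependent.map' C.subtype (Submodule.ker_subtype _), ?_⟩
    rw [Set.range_comp, ← Submodule.map_span, B.span_eq, Submodule.map_subtype_top]
    exact hC.symm
  choose I b hb hC using hcompl
  have hspan : ∀ w, Submodule.span k
      {m | ∃ j : Σ v, I v, ∃ h : j.1 = w, h ▸ b j.1 j.2 = m} ⊔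
        LinearMap.range (incoming act w) = ⊤ := fun w => by
    rw [eq_top_iff, ← (hC w).sup_eq_top]
    refine sup_le_sup_right (Submodule.span_mono ?_) _
    rintro _ ⟨i, rfl⟩
    exact ⟨⟨w, i⟩, rfl, rfl⟩
  have hli := linearIndependent_pathAct hd h hb fun w => (hC w).disjoint
  have htop := span_pathAct_eq_top (act := act) hd hspan
  exact ⟨Σ v, I v, Sigma.fst, fun j => b j.1 j.2, fun v =>
    ⟨Module.Basis.mk (hli v) (htop v).ge, fun p => Module.Basis.mk_apply _ _ _⟩⟩

end FreeRepresentation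

section PathCategory

variable {Q : Type} [Quiver.{0} Q]

/-- A path of `Q`, seen as a morphism of the path category `kQ`. -/
noncomputable def pathHom {v w : Q} (p : Quiver.Path v w) : vtx k Q v ⟶ vtx k Q w :=
  (Free.embedding k (Paths Q)).map (X := (v : Q)) (Y := (w : Q)) p

lemma pathHom_nil (v : Q) : pathHom k (Quiver.Path.nil : Quiver.Path v v) = 𝟙 (vtx k Q v) :=
  (Free.embedding k (Paths Q)).map_id _

lemma pathHom_cons {v w u : Q} (p : Quiver.Path v w) (a : w ⟶ u) :
    pathHom k (p.cons a) = pathHom k p ≫ arrHom k Q a :=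
  (Free.embedding k (Paths Q)).map_comp (X := (v : Q)) (Y := (w : Q)) (Z := (u : Q)) p a.toPath

/-- The paths form a basis of the morphism spaces of the path category. -/
noncomputable def pathBasis (v w : Q) :
    Module.Basis (Quiver.Path v w) k (vtx k Q v ⟶ vtx k Q w) :=
  ⟨LinearEquiv.refl k (Quiver.Path v w →₀ k)⟩

lemma repr_comp_arrHom_cons {x z y : Q} (u : vtx k Q x ⟶ vtx k Q z) (a : z ⟶ y)
    (p : Quiver.Path x z) :
    (pathBasis k x y).repr (u ≫ arrHom k Q a) (p.cons a) = (pathBasis k x z).repr u p := by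
  classical
  suffices (pathBasis k x y).coord (p.cons a) ∘ₗ Linear.rightComp k _ (arrHom k Q a) =
      (pathBasis k x z).coord p from LinearMap.congr_fun this u
  refine (pathBasis k x z).ext fun q => ?_
  have hq : pathBasis k x z q ≫ arrHom k Q a = pathBasis k x y (q.cons a) :=
    (pathHom_cons k q a).symm
  simp [hq, Finsupp.single_apply]

lemma repr_comp_arrHom_cons_of_ne {x y : Q} {a b : Σ z : Q, z ⟶ y} (hab : a ≠ b)
    (u : vtx k Q x ⟶ vtx k Q a.1) (p : Quiver.Path x b.1) :
    (pathBasis k x y).repr (u ≫ arrHom k Q a.2) (p.cons b.2) = 0 := by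
  classical
  suffices (pathBasis k x y).coord (p.cons b.2) ∘ₗ Linear.rightComp k _ (arrHom k Q a.2) = 0
    from LinearMap.congr_fun this u
  refine (pathBasis k x a.1).ext fun q => ?_
  have hq : pathBasis k x a.1 q ≫ arrHom k Q a.2 = pathBasis k x y (q.cons a.2) :=
    (pathHom_cons k q a.2).symm
  have hne : q.cons a.2 ≠ p.cons b.2 := by
    intro h
    obtain ⟨z, a⟩ := a
    obtain ⟨w, b⟩ := b
    cases h
    exact hab rfl
  simp [hq, hne]

variable {k}

/-- The action of the arrows of `Q` on a functor defined on the path category. -/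
noncomputable def arrAct (N : PathCat k Q ⥤ ModuleCat.{0} k) ⦃v w : Q⦄ (a : v ⟶ w) :
    N.obj (vtx k Q v) →ₗ[k] N.obj (vtx k Q w) :=
  (N.map (arrHom k Q a)).hom

lemma pathAct_arrAct (N : PathCat k Q ⥤ ModuleCat.{0} k) {v w : Q} (p : Quiver.Path v w) :
    pathAct (V := fun v => N.obj (vtx k Q v)) (arrAct N) p = (N.map (pathHom k p)).hom := by
  induction p with
  | nil => simp [pathAct, pathHom_nil]
  | cons p a ih => rw [pathAct, ih, pathHom_cons, N.map_comp]; rfl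

variable [∀ y : Q, Fintype (Σ z : Q, z ⟶ y)]

lemma eq_zero_of_sum_comp_arrHom_eq_zero {x y : Q}
    (u : ∀ a : Σ z : Q, z ⟶ y, vtx k Q x ⟶ vtx k Q a.1)
    (hu : ∑ a, u a ≫ arrHom k Q a.2 = 0) (b : Σ z : Q, z ⟶ y) : u b = 0 := by
  refine (pathBasis k x b.1).repr.injective (Finsupp.ext fun p => ?_)
  have hp := DFunLike.congr_fun (congrArg (pathBasis k x y).repr hu) (p.cons b.2)
  rw [map_sum, Finsupp.finsetSum_apply, Finset.sum_eq_single b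
    (fun a _ hab => repr_comp_arrHom_cons_of_ne k hab _ p) (by simp),
    repr_comp_arrHom_cons] at hp
  rw [hp, map_zero, map_zero]
  rfl

lemma incoming_projAt_injective (x y : Q) :
    Function.Injective (incoming (V := fun v => (ProjAt k (vtx k Q x)).obj (vtx k Q v))
      (arrAct (ProjAt k (vtx k Q x))) y) := by
  rw [injective_iff_map_eq_zero]
  intro u hu
  rw [incoming_apply] at hu
  exact funext (eq_zero_of_sum_comp_arrHom_eq_zero u hu)

lemma incoming_injective_of_jointly_injective {J : Type} {N : PathCat k Q ⥤ ModuleCat.{0} k}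
    {T : J → PathCat k Q ⥤ ModuleCat.{0} k} (g : ∀ j, N ⟶ T j)
    (hg : ∀ (v : Q) (m : N.obj (vtx k Q v)), (∀ j, (g j).app (vtx k Q v) m = 0) → m = 0) (y : Q)
    (hT : ∀ j, Function.Injective
      (incoming (V := fun v => (T j).obj (vtx k Q v)) (arrAct (T j)) y)) :
    Function.Injective (incoming (V := fun v => N.obj (vtx k Q v)) (arrAct N) y) := by
  rw [injective_iff_map_eq_zero]
  intro u hu
  funext a
  refine hg _ _ fun j => ?_
  suffices (fun a : Σ z : Q, z ⟶ y => (g j).app (vtx k Q a.1) (u a)) = 0 from congrFun this a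
  refine (injective_iff_map_eq_zero _).1 (hT j) _ ?_
  rw [incoming_apply] at hu ⊢
  have hj := congrArg ((g j).app (vtx k Q y)).hom hu
  rw [map_sum, map_zero] at hj
  rw [← hj]
  refine Finset.sum_congr rfl fun a _ => ?_
  exact (ConcreteCategory.congr_hom ((g j).naturality (arrHom k Q a.2)) (u a)).symm

end PathCategory

section Biproduct

variable {A : Type} [Category.{0} A]

lemma eq_zero_of_biproduct_π_app_eq_zero {r : ℕ} (N : Fin r → A ⥤ ModuleCat.{0} k) (a : A)
    (m : (⨁ N).obj a) (hm : ∀ i, (biproduct.π N i).app a m = 0) : m = 0 := by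
  have htot := congrArg (fun t : ⨁ N ⟶ ⨁ N => (t.app a).hom m) (biproduct.total (f := N))
  simp only [NatTrans.app_sum, ModuleCat.hom_sum, LinearMap.sum_apply, NatTrans.id_app,
    ModuleCat.hom_id, LinearMap.id_apply, NatTrans.comp_app, ModuleCat.hom_comp,
    LinearMap.comp_apply] at htot
  rw [← htot]
  exact Finset.sum_eq_zero fun i _ => by rw [hm i, map_zero]

end Biproduct

section Yoneda

variable {k} {Q : Type} [Quiver.{0} Q] {M : PathCat k Q ⥤ ModuleCat.{0} k}

/-- The morphism `P_y ⟶ M` corresponding to an element of `M(y)`. -/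
noncomputable def projDesc (hM : IsMod k M) {y : PathCat k Q} (b : M.obj y) :
    ProjAt k y ⟶ M where
  app v := ModuleCat.ofHom
    { toFun := fun g : y ⟶ v => M.map g b
      map_add' := fun g h => by rw [hM.1]; rfl
      map_smul' := fun c g => by rw [hM.2]; rfl }
  naturality v w g := by
    ext (h : y ⟶ v)
    change M.map (h ≫ g) b = M.map g (M.map h b)
    rw [M.map_comp]
    rfl

/-- A family of elements of `M` whose path translates form bases exhibits `M` as a coproduct of
projective modules. -/
theorem nonempty_iso_coproduct_of_basis (hM : IsMod k M) {ι : Type} {y : ι → Q}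
    (b : ∀ j, M.obj (vtx k Q (y j)))
    (B : ∀ v : Q, Module.Basis (Σ j, Quiver.Path (y j) v) k (M.obj (vtx k Q v)))
    (hB : ∀ v p, B v p = M.map (pathHom k p.2) (b p.1)) :
    Nonempty (M ≅ ∐ fun j => ProjAt k (vtx k Q (y j))) := by
  have hc : ∀ v : Q, Nonempty (IsColimit (Cofan.mk (M.obj (vtx k Q v))
      fun j => (projDesc hM (b j)).app (vtx k Q v))) := fun v => by
    refine ⟨Cofan.IsColimit.mk _ (fun s => ModuleCat.ofHom ((B v).constr k fun p =>
      (s.inj p.1).hom (pathHom k p.2 : vtx k Q (y p.1) ⟶ vtx k Q v))) (fun s j => ?_)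
      fun s m hm => ?_⟩
    · refine ModuleCat.hom_ext ((pathBasis k (y j) v).ext fun p => ?_)
      change (B v).constr k _ (M.map (pathHom k p) (b j)) = _
      rw [← hB v ⟨j, p⟩, Module.Basis.constr_basis]
      rfl
    · refine ModuleCat.hom_ext ((B v).ext fun p => ?_)
      rw [ModuleCat.hom_ofHom, Module.Basis.constr_basis, ← hm p.1, hB]
      rfl
  have hcol : IsColimit (Cofan.mk M fun j => projDesc hM (b j)) :=
    evaluationJointlyReflectsColimits _ fun v =>
      (isColimitMapCoconeCofanMkEquiv ((evaluation _ _).obj v) _ _).symm (hc v).some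
  exact ⟨hcol.coconePointUniqueUpToIso (coproductIsCoproduct _)⟩

end Yoneda

variable (k : Type) [Field k] [IsAlgClosed k]
variable (Q : Type) [Quiver.{0} Q]

/-- For a strongly locally finite quiver `Q`, every submodule of a finite direct sum of
projective modules `P_{x_i}` is isomorphic to a (possibly infinite) direct sum of modules
of the form `P_y`. -/
theorem statement_3 (hQ : StronglyLocallyFinite Q) (r : ℕ) (x : Fin r → Q)
    (M : PathCat k Q ⥤ ModuleCat.{0} k) (hM : IsMod k M)
    (f : M ⟶ ⨁ fun i => ProjAt k (vtx k Q (x i))) (hf : Mono f) :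
    ∃ (ι : Type) (y : ι → Q), Nonempty (M ≅ ∐ fun i : ι => ProjAt k (vtx k Q (y i))) := by
  classical
  obtain ⟨hloc, hfin⟩ := hQ
  have : ∀ v w : Q, Finite (Quiver.Path v w) := hfin
  have (y : Q) : Finite (Σ z : Q, z ⟶ y) := (hloc y).2
  let (y : Q) : Fintype (Σ z : Q, z ⟶ y) := Fintype.ofFinite _
  let (v : Q) : Fintype (Σ i, Quiver.Path (x i) v) := Fintype.ofFinite _
  let g : ∀ i, M ⟶ ProjAt k (vtx k Q (x i)) := fun i => f ≫ biproduct.π _ i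
  have hg : ∀ (v : Q) (m : M.obj (vtx k Q v)), (∀ i, (g i).app (vtx k Q v) m = 0) → m = 0 := by
    intro v m hm
    have hinj : Function.Injective (f.app (vtx k Q v)) :=
      (ModuleCat.mono_iff_injective _).1 inferInstance
    refine (injective_iff_map_eq_zero (f.app (vtx k Q v)).hom).1 hinj _ ?_
    exact eq_zero_of_biproduct_π_app_eq_zero k _ _ _ hm
  let d : Q → ℕ := fun v => Finset.univ.sup fun p : Σ i, Quiver.Path (x i) v => p.2.length
  have hd : ∀ ⦃z v : Q⦄, (z ⟶ v) → Nontrivial (M.obj (vtx k Q z)) → d z < d v := by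
    intro z v a hz
    have hne : Nonempty (Σ i, Quiver.Path (x i) z) := by
      by_contra hempty
      rw [not_nonempty_iff] at hempty
      refine not_subsingleton (M.obj (vtx k Q z)) (subsingleton_of_forall_eq 0 fun m => ?_)
      refine hg z m fun i => ?_
      have : IsEmpty (Quiver.Path (x i) z) := ⟨fun p => hempty.false ⟨i, p⟩⟩
      exact (pathBasis k (x i) z).repr.injective (Subsingleton.elim _ _)
    obtain ⟨p, -, hp⟩ := Finset.exists_mem_eq_sup Finset.univ Finset.univ_nonempty
      fun p : Σ i, Quiver.Path (x i) z => p.2.length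
    have hle := Finset.le_sup (f := fun p : Σ i, Quiver.Path (x i) v => p.2.length)
      (Finset.mem_univ ⟨p.1, p.2.cons a⟩)
    exact (hp.trans_lt (Nat.lt_succ_self _)).trans_le hle
  obtain ⟨ι, y, b, hB⟩ := exists_basis_pathAct (V := fun v => M.obj (vtx k Q v))
    (act := arrAct M) hd fun y => incoming_injective_of_jointly_injective g hg y
      fun i => incoming_projAt_injective (x i) y
  choose B hB using hB
  exact ⟨ι, y, nonempty_iso_coproduct_of_basis hM b B fun v p => by
    rw [hB, pathAct_arrAct]⟩

end Paper
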